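/- arXiv:2305.13558 — 2 statements merged into one kernel-verified Lean document; each statement's English description precedes it below -/
import Mathlib

section
/- Let k be a field and n ≥ 1. If σ and σ' are permutations of {1,…,n}, L and L' are invertible lower triangular n×n matrices over k, and U and U' are invertible upper triangular n×n matrices over k such that L · P_σ · U = L' · P_{σ'} · U', then σ = σ'. -/
/-- The permutation matrix of `σ`: the `(i,j)` entry is `1` if `i = σ j` and `0` otherwise. -/
def permMat {k : Type*} [Field k] {n : ℕ} (σ : Equiv.Perm (Fin n)) :
    Matrix (Fin n) (Fin n) k :=
  Matrix.of fun i j => if i = σ j then 1 else 0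

/-- A permutation of a well-ordered type that moves no element up is the identity. -/
theorem Equiv.Perm.eq_one_of_forall_apply_le {α : Type*} [LinearOrder α] [WellFoundedLT α]
    (τ : Equiv.Perm α) (h : ∀ a, τ a ≤ a) : τ = 1 := by
  ext a
  induction a using WellFoundedLT.induction with
  | ind a ih =>
    rcases (h a).lt_or_eq with hlt | heq
    · exact absurd (τ.injective (ih _ hlt)) hlt.ne
    · exact heq

theorem mul_permMat_apply {k : Type*} [Field k] {n : ℕ} (A : Matrix (Fin n) (Fin n) k)
    (σ : Equiv.Perm (Fin n)) (i j : Fin n) :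
    (A * permMat σ : Matrix (Fin n) (Fin n) k) i j = A i (σ j) := by
  simp [Matrix.mul_apply, permMat]

theorem permMat_mul_apply {k : Type*} [Field k] {n : ℕ} (A : Matrix (Fin n) (Fin n) k)
    (σ : Equiv.Perm (Fin n)) (i j : Fin n) :
    (permMat σ * A : Matrix (Fin n) (Fin n) k) i j = A (σ.symm i) j := by
  simp [Matrix.mul_apply, permMat, ← Equiv.symm_apply_eq]

/-- The diagonal entries of an invertible lower triangular matrix are nonzero. -/
theorem Matrix.BlockTriangular.diag_ne_zero_of_isUnit {k : Type*} [Field k] {n : ℕ}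
    {A : Matrix (Fin n) (Fin n) k} (hA : A.BlockTriangular OrderDual.toDual) (hu : IsUnit A)
    (i : Fin n) : A i i ≠ 0 := by
  have hdet : A.det ≠ 0 := ((Matrix.isUnit_iff_isUnit_det A).mp hu).ne_zero
  rw [Matrix.det_of_isLowerTriangular A hA] at hdet
  exact Finset.prod_ne_zero_iff.mp hdet i (Finset.mem_univ i)

/-- The inverse of an invertible block triangular matrix is block triangular. -/
theorem Matrix.BlockTriangular.inv_of_isUnit {m α k : Type*} [Fintype m] [DecidableEq m]
    [LinearOrder α] [Field k] {A : Matrix m m k} {b : m → α} (hA : A.BlockTriangular b)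
    (hu : IsUnit A) : A⁻¹.BlockTriangular b := by
  let _ := hu.invertible
  exact Matrix.blockTriangular_inv_of_blockTriangular hA

/-- Uniqueness part of the Bruhat decomposition for `GL_n`: if
`L * P_σ * U = L' * P_σ' * U'` with `L, L'` invertible lower triangular and `U, U'`
invertible upper triangular, then `σ = σ'`. -/
theorem bruhat_uniqueness {k : Type*} [Field k] {n : ℕ} (hn : 1 ≤ n)
    (σ σ' : Equiv.Perm (Fin n)) (L L' U U' : Matrix (Fin n) (Fin n) k)
    (hL : IsUnit L) (hLtri : ∀ i j : Fin n, i < j → L i j = 0)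
    (hL' : IsUnit L') (hL'tri : ∀ i j : Fin n, i < j → L' i j = 0)
    (hU : IsUnit U) (hUtri : ∀ i j : Fin n, j < i → U i j = 0)
    (hU' : IsUnit U') (hU'tri : ∀ i j : Fin n, j < i → U' i j = 0)
    (heq : L * permMat σ * U = L' * permMat σ' * U') :
    σ = σ' := by
  have hLb : L.BlockTriangular OrderDual.toDual := fun i j hij => hLtri i j hij
  have hL'b : L'.BlockTriangular OrderDual.toDual := fun i j hij => hL'tri i j hij
  have hUb : U.BlockTriangular id := fun i j hij => hUtri i j hij
  have hU'b : U'.BlockTriangular id := fun i j hij => hU'tri i j hij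
  have hA : (L'⁻¹ * L).BlockTriangular OrderDual.toDual := (hL'b.inv_of_isUnit hL').mul hLb
  have hV : (U' * U⁻¹).BlockTriangular id := hU'b.mul (hUb.inv_of_isUnit hU)
  have hAu : IsUnit (L'⁻¹ * L) := (Matrix.isUnit_nonsing_inv_iff.mpr hL').mul hL
  have key : L'⁻¹ * L * permMat σ = permMat σ' * (U' * U⁻¹) := by
    calc L'⁻¹ * L * permMat σ = L'⁻¹ * (L * permMat σ * U) * U⁻¹ := by
          simp only [Matrix.mul_assoc,
            Matrix.mul_nonsing_inv U ((Matrix.isUnit_iff_isUnit_det U).mp hU), Matrix.mul_one]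
      _ = L'⁻¹ * L' * permMat σ' * (U' * U⁻¹) := by
          rw [heq]
          simp only [Matrix.mul_assoc]
      _ = permMat σ' * (U' * U⁻¹) := by
          rw [Matrix.nonsing_inv_mul L' ((Matrix.isUnit_iff_isUnit_det L').mp hL'),
            Matrix.one_mul]
  have hle : ∀ j, (σ'⁻¹ * σ) j ≤ j := by
    intro j
    by_contra! hlt
    apply hA.diag_ne_zero_of_isUnit hAu (σ j)
    rw [← mul_permMat_apply (L'⁻¹ * L), key, permMat_mul_apply]
    exact hV hlt
  exact (inv_mul_eq_one.mp (Equiv.Perm.eq_one_of_forall_apply_le _ hle)).symm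
end

section
/- Let k be an algebraically closed field of characteristic 0 and let R = k[x_{ij} : 1 ≤ i,j ≤ 3]/(det(x_{ij}) − 1) be the coordinate ring of SL₃. Let φ : k[a,b,c,d,e,f] → R be the k-algebra homomorphism determined by φ(a) = x₃₁, φ(b) = x₃₂, φ(c) = x₃₃, φ(d) = x₂₂x₃₃ − x₂₃x₃₂, φ(e) = x₂₃x₃₁ − x₂₁x₃₃, φ(f) = x₂₁x₃₂ − x₂₂x₃₁. Then the kernel of φ is the principal ideal generated by ad + be + cf; in particular the image of φ is isomorphic as a k-algebra to k[a,b,c,d,e,f]/(ad + be + cf). -/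
open MvPolynomial

/-- The generic `3 × 3` matrix of variables. -/
noncomputable def genMat (k : Type*) [CommRing k] :
    Matrix (Fin 3) (Fin 3) (MvPolynomial (Fin 3 × Fin 3) k) :=
  Matrix.of fun i j => X (i, j)

/-- The ideal `⟨det(x_{ij}) - 1⟩` defining `SL₃`. -/
noncomputable def sl3Ideal (k : Type*) [CommRing k] :
    Ideal (MvPolynomial (Fin 3 × Fin 3) k) :=
  Ideal.span {(genMat k).det - 1}

/-- The coordinate ring `R = k[x_{ij}]/(det - 1)` of `SL₃`. -/
abbrev SL3Ring (k : Type*) [CommRing k] : Type _ :=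
  MvPolynomial (Fin 3 × Fin 3) k ⧸ sl3Ideal k

/-- The `k`-algebra map `φ : k[a,b,c,d,e,f] → k[SL₃]` sending `a, b, c` to the third-row
entries `x₃₁, x₃₂, x₃₃` and `d, e, f` to the `2 × 2` minors of the bottom two rows
(indices are `0`-based, so `x₃₁` is `X (2,0)`, etc.). -/
noncomputable def phiSL3 (k : Type*) [Field k] : MvPolynomial (Fin 6) k →ₐ[k] SL3Ring k :=
  aeval
    ![Ideal.Quotient.mk (sl3Ideal k) (X (2, 0)),
      Ideal.Quotient.mk (sl3Ideal k) (X (2, 1)),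
      Ideal.Quotient.mk (sl3Ideal k) (X (2, 2)),
      Ideal.Quotient.mk (sl3Ideal k) (X (1, 1) * X (2, 2) - X (1, 2) * X (2, 1)),
      Ideal.Quotient.mk (sl3Ideal k) (X (1, 2) * X (2, 0) - X (1, 0) * X (2, 2)),
      Ideal.Quotient.mk (sl3Ideal k) (X (1, 0) * X (2, 1) - X (1, 1) * X (2, 0))]

/-- The quadric equation `ad + be + cf` is a prime element. -/
theorem prime_quadric (k : Type*) [Field k] :
    Prime (X 0 * X 3 + X 1 * X 4 + X 2 * X 5 : MvPolynomial (Fin 6) k) := by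
  have h : ¬ (X 0 : MvPolynomial (Fin 6) k) ∣ X 1 * X 4 + X 2 * X 5 := by
    rintro ⟨s, hs⟩
    simpa using congrArg (eval ![0, 1, 0, 0, 1, 0]) hs
  have hvars : (X 1 * X 4 + X 2 * X 5 : MvPolynomial (Fin 6) k) ∈ supported k {i | i ≠ 3} :=
    add_mem (mul_mem (X_mem_supported.2 (by decide)) (X_mem_supported.2 (by decide)))
      (mul_mem (X_mem_supported.2 (by decide)) (X_mem_supported.2 (by decide)))
  rw [add_assoc]
  exact (irreducible_mul_X_add (X 0) (X 1 * X 4 + X 2 * X 5) 3 (X_ne_zero 0) (by simp [vars_X])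
    (fun hm => mem_supported.1 hvars hm rfl)
    ((X_prime (R := k) (i := (0 : Fin 6))).irreducible.isRelPrime_iff_not_dvd.2 h)).prime

/-- Modulo `ad + be + cf`, every polynomial becomes independent of `d` after multiplication by
a power of `a`. -/
theorem exists_pow_mul_sub_mem_supported {k : Type*} [Field k] (p : MvPolynomial (Fin 6) k) :
    ∃ N : ℕ, ∃ r ∈ supported k {i : Fin 6 | i ≠ 3},
      (X 0 * X 3 + X 1 * X 4 + X 2 * X 5 : MvPolynomial (Fin 6) k) ∣ X 0 ^ N * p - r := by
  have hX : ∀ i : Fin 6, i ≠ 3 → (X i : MvPolynomial (Fin 6) k) ∈ supported k {i | i ≠ 3} :=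
    fun i hi => X_mem_supported.2 hi
  induction p using MvPolynomial.induction_on with
  | C a => exact ⟨0, C a, Subalgebra.algebraMap_mem _ a, by simp⟩
  | add p p' hp hp' =>
    obtain ⟨N, r, hr, g, hg⟩ := hp
    obtain ⟨N', r', hr', g', hg'⟩ := hp'
    refine ⟨N + N', X 0 ^ N' * r + X 0 ^ N * r', add_mem
      (mul_mem (pow_mem (hX 0 (by decide)) _) hr) (mul_mem (pow_mem (hX 0 (by decide)) _) hr'),
      X 0 ^ N' * g + X 0 ^ N * g', ?_⟩
    linear_combination X 0 ^ N' * hg + X 0 ^ N * hg'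
  | mul_X p i hp =>
    obtain ⟨N, r, hr, g, hg⟩ := hp
    by_cases hi : i = 3
    · subst hi
      refine ⟨N + 1, -(X 1 * X 4 + X 2 * X 5) * r, mul_mem (neg_mem (add_mem
        (mul_mem (hX 1 (by decide)) (hX 4 (by decide)))
        (mul_mem (hX 2 (by decide)) (hX 5 (by decide))))) hr, X 0 * X 3 * g + r, ?_⟩
      linear_combination X 0 * X 3 * hg
    · refine ⟨N, r * X i, mul_mem hr (hX i hi), g * X i, ?_⟩
      linear_combination X i * hg

/-- The `FractionRing k[a,…,f]`-point of `SL₃` with rows `(0, 1/e, 0)`, `(0, -f/a, e/a)` and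
`(a, b, c)`. -/
noncomputable def sl3Point (k : Type*) [Field k] :
    Matrix (Fin 3) (Fin 3) (FractionRing (MvPolynomial (Fin 6) k)) :=
  let x (i : Fin 6) :=
    algebraMap (MvPolynomial (Fin 6) k) (FractionRing (MvPolynomial (Fin 6) k)) (X i)
  !![0, (x 4)⁻¹, 0; 0, -x 5 / x 0, x 4 / x 0; x 0, x 1, x 2]

theorem algebraMap_X_ne_zero (k : Type*) [Field k] (i : Fin 6) :
    algebraMap (MvPolynomial (Fin 6) k) (FractionRing (MvPolynomial (Fin 6) k)) (X i) ≠ 0 := by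
  simp

/-- Evaluation of regular functions on `SL₃` at `sl3Point`. -/
noncomputable def evalSL3Point (k : Type*) [Field k] :
    SL3Ring k →ₐ[k] FractionRing (MvPolynomial (Fin 6) k) :=
  Ideal.Quotient.liftₐ (sl3Ideal k) (aeval fun ij => sl3Point k ij.1 ij.2) <| by
    suffices h : sl3Ideal k ≤ RingHom.ker
        (aeval (R := k) fun ij : Fin 3 × Fin 3 => sl3Point k ij.1 ij.2) from fun a ha => h ha
    rw [sl3Ideal, Ideal.span_singleton_le_iff_mem, RingHom.mem_ker]
    have h0 := algebraMap_X_ne_zero k 0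
    have h4 := algebraMap_X_ne_zero k 4
    simp [Matrix.det_fin_three, genMat, sl3Point]
    field_simp
    ring

theorem evalSL3Point_mk (k : Type*) [Field k] (p : MvPolynomial (Fin 3 × Fin 3) k) :
    evalSL3Point k (Ideal.Quotient.mk (sl3Ideal k) p) =
      aeval (fun ij => sl3Point k ij.1 ij.2) p :=
  rfl

theorem evalSL3Point_phiSL3_X (k : Type*) [Field k] {i : Fin 6} (hi : i ≠ 3) :
    evalSL3Point k (phiSL3 k (X i)) = algebraMap _ _ (X i : MvPolynomial (Fin 6) k) := by
  fin_cases i <;> simp [phiSL3, evalSL3Point_mk, sl3Point] at hi ⊢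

theorem evalSL3Point_phiSL3_of_mem_supported {k : Type*} [Field k]
    {r : MvPolynomial (Fin 6) k} (hr : r ∈ supported k {i : Fin 6 | i ≠ 3}) :
    evalSL3Point k (phiSL3 k r) = algebraMap _ _ r := by
  have h : supported k {i : Fin 6 | i ≠ 3} ≤ AlgHom.equalizer ((evalSL3Point k).comp (phiSL3 k))
      (IsScalarTower.toAlgHom k _ (FractionRing (MvPolynomial (Fin 6) k))) := by
    refine Algebra.adjoin_le ?_
    rintro _ ⟨i, hi, rfl⟩
    exact evalSL3Point_phiSL3_X k hi
  exact h hr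

theorem phiSL3_quadric (k : Type*) [Field k] :
    phiSL3 k (X 0 * X 3 + X 1 * X 4 + X 2 * X 5) = 0 := by
  simp [phiSL3]
  ring

theorem quadric_dvd_of_phiSL3_eq_zero {k : Type*} [Field k] {p : MvPolynomial (Fin 6) k}
    (hp : phiSL3 k p = 0) :
    (X 0 * X 3 + X 1 * X 4 + X 2 * X 5 : MvPolynomial (Fin 6) k) ∣ p := by
  obtain ⟨N, r, hr, g, hg⟩ := exists_pow_mul_sub_mem_supported p
  have hφr : phiSL3 k r = 0 := by
    have h := congrArg (phiSL3 k) hg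
    rw [map_sub, map_mul, map_mul, hp, phiSL3_quadric] at h
    simpa using h
  have hr0 : r = 0 := by
    have h := evalSL3Point_phiSL3_of_mem_supported hr
    rw [hφr, map_zero] at h
    exact (IsFractionRing.injective _ (FractionRing (MvPolynomial (Fin 6) k))) (by simp [← h])
  rw [hr0, sub_zero] at hg
  refine ((prime_quadric k).dvd_or_dvd ⟨g, hg⟩).resolve_left fun h => ?_
  obtain ⟨s, hs⟩ := (prime_quadric k).dvd_of_dvd_pow h
  have := congrArg (eval (Pi.single 0 1)) hs
  simp at this

/-- The kernel of `φ` is the principal ideal `⟨ad + be + cf⟩`; in particular the image of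
`φ` is isomorphic to `k[a,b,c,d,e,f]/⟨ad + be + cf⟩`. -/
theorem ker_phiSL3 (k : Type*) [Field k] [IsAlgClosed k] [CharZero k] :
    RingHom.ker (phiSL3 k).toRingHom
        = Ideal.span {(X 0 * X 3 + X 1 * X 4 + X 2 * X 5 : MvPolynomial (Fin 6) k)} ∧
    Nonempty
      ((MvPolynomial (Fin 6) k ⧸
          Ideal.span {(X 0 * X 3 + X 1 * X 4 + X 2 * X 5 : MvPolynomial (Fin 6) k)})
        ≃ₐ[k] (phiSL3 k).range) := by
  have hker : RingHom.ker (phiSL3 k) =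
      Ideal.span {(X 0 * X 3 + X 1 * X 4 + X 2 * X 5 : MvPolynomial (Fin 6) k)} := by
    ext p
    rw [RingHom.mem_ker, Ideal.mem_span_singleton]
    refine ⟨quadric_dvd_of_phiSL3_eq_zero, ?_⟩
    rintro ⟨g, rfl⟩
    rw [map_mul, phiSL3_quadric, zero_mul]
  exact ⟨hker, ⟨(Ideal.quotientEquivAlgOfEq k hker.symm).trans
    (Ideal.quotientKerEquivRange (phiSL3 k))⟩⟩
end
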